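/- arXiv:2311.11987 — 2 statements merged into one kernel-verified Lean document; each statement's English description precedes it below -/
import Mathlib

section
/- Let L be a nilpotent symplectic alternating algebra with dim L > 2 and dim Z(L) = 2. Then dim Z_2(L) = 3, or equivalently dim L^3 = dim L^2 − 1. -/
/-- A symplectic alternating algebra structure on an `F`-vector space `L`:
a nondegenerate alternating bilinear form together with an alternating
bilinear product satisfying `(x·y, z) = (y·z, x)`. -/
structure SAAStruct (F : Type*) [Field F] (L : Type*) [AddCommGroup L] [Module F L] where
  form : L →ₗ[F] L →ₗ[F] F
  mul : L →ₗ[F] L →ₗ[F] L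
  form_alt : ∀ x : L, form x x = 0
  form_nondegen : ∀ x : L, (∀ y : L, form x y = 0) → x = 0
  mul_alt : ∀ x : L, mul x x = 0
  cyclic : ∀ x y z : L, form (mul x y) z = form (mul y z) x

namespace SAAStruct

variable {F : Type*} [Field F] {L : Type*} [AddCommGroup L] [Module F L]

/-- `I` is an ideal of the symplectic alternating algebra `A`. -/
def IsIdealSub (A : SAAStruct F L) (I : Submodule F L) : Prop :=
  ∀ x ∈ I, ∀ y : L, A.mul x y ∈ I

/-- An ascending chain of ideals `⊥ = I 0 ≤ I 1 ≤ ⋯ ≤ I k = ⊤`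
with `I (s+1) · L ⊆ I s`. -/
def CentralChain (A : SAAStruct F L) (I : ℕ → Submodule F L) (k : ℕ) : Prop :=
  I 0 = ⊥ ∧ I k = ⊤ ∧ (∀ s, s < k → I s ≤ I (s + 1)) ∧
  (∀ s, s ≤ k → A.IsIdealSub (I s)) ∧
  (∀ s, s < k → ∀ x ∈ I (s + 1), ∀ y : L, A.mul x y ∈ I s)

/-- `A` is nilpotent if it admits a central chain of ideals. -/
def IsNilpotent (A : SAAStruct F L) : Prop :=
  ∃ (k : ℕ) (I : ℕ → Submodule F L), A.CentralChain I k

/-- The nilpotency class of `A`: the least length of a central chain of ideals. -/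
noncomputable def nilClass (A : SAAStruct F L) : ℕ :=
  sInf {k | ∃ I : ℕ → Submodule F L, A.CentralChain I k}

/-- The center `Z(L) = {x : x·L = 0}`. -/
def center (A : SAAStruct F L) : Submodule F L := LinearMap.ker A.mul

/-- The lower central series, indexed so that `lcs A i` is `L^(i+1)`:
`lcs A 0 = L¹ = L` and `lcs A (i+1) = L^(i+2) = span {u·v : u ∈ L^(i+1), v ∈ L}`. -/
def lcs (A : SAAStruct F L) : ℕ → Submodule F L
  | 0 => ⊤
  | (i + 1) => Submodule.span F {z | ∃ u ∈ A.lcs i, ∃ v : L, z = A.mul u v}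

/-- The upper central series: `ucs A 0 = 0`, `ucs A (i+1) = {x : x·L ⊆ ucs A i}`. -/
def ucs (A : SAAStruct F L) : ℕ → Submodule F L
  | 0 => ⊥
  | (i + 1) =>
    { carrier := {x | ∀ y : L, A.mul x y ∈ A.ucs i}
      add_mem' := by
        intro a b ha hb y
        simpa [map_add, LinearMap.add_apply] using
          Submodule.add_mem _ (ha y) (hb y)
      zero_mem' := by
        intro y
        simp
      smul_mem' := by
        intro c a ha y
        simpa [map_smul, LinearMap.smul_apply] using
          Submodule.smul_mem _ c (ha y) }

/-- The perp `U^⊥ = {x : (x,u) = 0 for all u ∈ U}` of a subspace with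
respect to the alternating form of `A`. -/
def perp (A : SAAStruct F L) (U : Submodule F L) : Submodule F L :=
  { carrier := {x | ∀ u ∈ U, A.form x u = 0}
    add_mem' := by
      intro a b ha hb u hu
      simp [map_add, LinearMap.add_apply, ha u hu, hb u hu]
    zero_mem' := by
      intro u hu
      simp
    smul_mem' := by
      intro c a ha u hu
      simp [map_smul, LinearMap.smul_apply, ha u hu] }

/-- A subspace is isotropic if the form vanishes identically on it. -/
def Isotropic (A : SAAStruct F L) (U : Submodule F L) : Prop :=
  ∀ u ∈ U, ∀ v ∈ U, A.form u v = 0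

/-- A subspace is abelian if the product vanishes identically on it. -/
def AbelianSub (A : SAAStruct F L) (U : Submodule F L) : Prop :=
  ∀ u ∈ U, ∀ v ∈ U, A.mul u v = 0

end SAAStruct

/-- The function `Ω` with `Ω 0 = 0` and `Ω (m+1) = 2 + C(Ω m, 2)`. -/
def OmegaFn : ℕ → ℕ
  | 0 => 0
  | (m + 1) => 2 + Nat.choose (OmegaFn m) 2

/-- The entries of the Gram matrix of a standard (symplectic) basis
`x₁, y₁, x₂, y₂, …` enumerated as `b 0 = x₁, b 1 = y₁, b 2 = x₂, …`. -/
def stdJ (F : Type*) [Field F] {N : ℕ} (i j : Fin N) : F :=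
  if (i : ℕ) % 2 = 0 ∧ (j : ℕ) = (i : ℕ) + 1 then 1
  else if (j : ℕ) % 2 = 0 ∧ (i : ℕ) = (j : ℕ) + 1 then -1
  else 0

namespace SAAStruct

section CentralSeries

variable {F : Type*} [Field F] {L : Type*} [AddCommGroup L] [Module F L]

lemma mul_comm_neg (A : SAAStruct F L) (x y : L) : A.mul x y = -A.mul y x :=
  (LinearMap.IsAlt.neg (B := A.mul) A.mul_alt y x).symm

lemma form_comm_neg (A : SAAStruct F L) (x y : L) : A.form x y = -A.form y x :=
  (LinearMap.IsAlt.neg (B := A.form) A.form_alt y x).symm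

lemma form_mul_right (A : SAAStruct F L) (x u v : L) :
    A.form x (A.mul u v) = A.form (A.mul x v) u := by
  rw [A.form_comm_neg, A.cyclic, A.mul_comm_neg v x]
  simp

lemma mul_mem_lcs_succ (A : SAAStruct F L) {i : ℕ} {u : L} (hu : u ∈ A.lcs i) (v : L) :
    A.mul u v ∈ A.lcs (i + 1) :=
  Submodule.subset_span ⟨u, hu, v, rfl⟩

lemma lcs_succ_le (A : SAAStruct F L) {i : ℕ} {U : Submodule F L} :
    A.lcs (i + 1) ≤ U ↔ ∀ u ∈ A.lcs i, ∀ v : L, A.mul u v ∈ U := by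
  refine ⟨fun h u hu v => h (A.mul_mem_lcs_succ hu v), fun h => Submodule.span_le.2 ?_⟩
  rintro _ ⟨u, hu, v, rfl⟩
  exact h u hu v

lemma lcs_antitone (A : SAAStruct F L) : Antitone A.lcs := by
  refine antitone_nat_of_succ_le fun i => ?_
  induction i with
  | zero => exact le_top
  | succ i ih => exact A.lcs_succ_le.2 fun u hu v => A.mul_mem_lcs_succ (ih hu) v

/-- The upper central series is the series of perps of the lower central series. -/
lemma ucs_eq_perp_lcs (A : SAAStruct F L) (i : ℕ) : A.ucs i = A.perp (A.lcs i) := by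
  induction i with
  | zero =>
    refine (bot_le : (⊥ : Submodule F L) ≤ _).antisymm fun x hx => ?_
    exact A.form_nondegen x fun y => hx y trivial
  | succ i ih =>
    ext x
    constructor
    · intro hx
      have hle : A.lcs (i + 1) ≤ LinearMap.ker (A.form x) := A.lcs_succ_le.2 fun u hu v => by
        have hxv : A.mul x v ∈ A.perp (A.lcs i) := ih ▸ hx v
        rw [LinearMap.mem_ker, A.form_mul_right]
        exact hxv u hu
      exact fun u hu => hle hu
    · intro hx v
      rw [ih]
      intro u hu
      rw [← A.form_mul_right]
      exact hx _ (A.mul_mem_lcs_succ hu v)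

lemma center_eq_ucs_one (A : SAAStruct F L) : A.center = A.ucs 1 := by
  ext x
  exact LinearMap.ext_iff

lemma finrank_perp_add [FiniteDimensional F L] (A : SAAStruct F L) (U : Submodule F L) :
    Module.finrank F (A.perp U) + Module.finrank F U = Module.finrank F L := by
  have hrefl : LinearMap.IsRefl A.form := LinearMap.IsAlt.isRefl A.form_alt
  have hnd : LinearMap.BilinForm.Nondegenerate A.form :=
    hrefl.nondegenerate_iff_separatingLeft.2 A.form_nondegen
  have hperp : A.perp U = LinearMap.BilinForm.orthogonal A.form U := by
    ext x
    exact ⟨fun h u hu => hrefl _ _ (h u hu), fun h u hu => hrefl _ _ (h u hu)⟩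
  have := LinearMap.BilinForm.finrank_orthogonal hnd U
  have := Submodule.finrank_le U
  rw [hperp]
  omega

lemma finrank_ucs_add_finrank_lcs [FiniteDimensional F L] (A : SAAStruct F L) (i : ℕ) :
    Module.finrank F (A.ucs i) + Module.finrank F (A.lcs i) = Module.finrank F L := by
  rw [A.ucs_eq_perp_lcs, A.finrank_perp_add]

/-- In a nilpotent algebra, a subspace `U` contained in `U · L` is trivial. -/
lemma IsNilpotent.eq_bot_of_le {A : SAAStruct F L} (hnil : A.IsNilpotent) {U : Submodule F L}
    (hU : ∀ V : Submodule F L, (∀ u ∈ U, ∀ v : L, A.mul u v ∈ V) → U ≤ V) : U = ⊥ := by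
  obtain ⟨k, I, hbot, htop, -, -, hI⟩ := hnil
  have hle : ∀ j ≤ k, U ≤ I (k - j) := by
    intro j
    induction j with
    | zero => intro _; simp [htop]
    | succ j ih =>
      intro hj
      refine hU _ fun u hu v => hI _ (by omega) u ?_ v
      rw [show k - (j + 1) + 1 = k - j by omega]
      exact ih (by omega) hu
  simpa [hbot] using hle k le_rfl

lemma IsNilpotent.lcs_succ_lt {A : SAAStruct F L} (hnil : A.IsNilpotent) {i : ℕ}
    (hi : A.lcs i ≠ ⊥) : A.lcs (i + 1) < A.lcs i := by
  refine lt_of_le_not_ge (A.lcs_antitone i.le_succ) fun hle => hi ?_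
  exact hnil.eq_bot_of_le fun V hV => hle.trans (A.lcs_succ_le.2 hV)

/-- If `L` is spanned by `a` and `b` modulo `L²`, then `L²` is spanned by `a · b` modulo `L³`. -/
lemma lcs_one_le_sup_span (A : SAAStruct F L) {a b : L}
    (hab : ∀ x : L, ∃ s ∈ A.lcs 1, ∃ α β : F, x = s + (α • a + β • b)) :
    A.lcs 1 ≤ A.lcs 2 ⊔ Submodule.span F {A.mul a b} := by
  refine A.lcs_succ_le.2 fun x _ y => ?_
  obtain ⟨s, hs, α, β, rfl⟩ := hab x
  obtain ⟨t, ht, γ, δ, rfl⟩ := hab y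
  set p := α • a + β • b with hp
  set q := γ • a + δ • b with hq
  have hpq : A.mul p q = (α * δ - β * γ) • A.mul a b := by
    simp only [hp, hq, map_add, map_smul, LinearMap.add_apply, LinearMap.smul_apply, A.mul_alt,
      A.mul_comm_neg b a]
    module
  have hsplit : A.mul (s + p) (t + q) =
      (A.mul s (t + q) - A.mul t p) + (α * δ - β * γ) • A.mul a b := by
    rw [← hpq, A.mul_comm_neg t p]
    simp only [map_add, LinearMap.add_apply]
    abel
  rw [hsplit]
  exact Submodule.add_mem_sup
    (sub_mem (A.mul_mem_lcs_succ hs _) (A.mul_mem_lcs_succ ht _))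
    (Submodule.smul_mem _ _ (Submodule.mem_span_singleton_self _))

end CentralSeries

end SAAStruct

/-- for a nilpotent SAA with `dim L > 2` and `dim Z(L) = 2`,
`dim Z₂(L) = 3`, equivalently `dim L³ = dim L² − 1`.
(Here `A.lcs 1 = L²`, `A.lcs 2 = L³` and `A.ucs i = Z_i(L)`.) -/
theorem stmt6 (F : Type*) [Field F] (L : Type*) [AddCommGroup L] [Module F L]
    [FiniteDimensional F L] (A : SAAStruct F L) (hnil : A.IsNilpotent)
    (hdim : 2 < Module.finrank F L) (hZ : Module.finrank F A.center = 2) :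
    Module.finrank F (A.ucs 2) = 3 ∧
      Module.finrank F (A.lcs 2) + 1 = Module.finrank F (A.lcs 1) := by
  have h1 := A.finrank_ucs_add_finrank_lcs 1
  have h2 := A.finrank_ucs_add_finrank_lcs 2
  rw [← A.center_eq_ucs_one, hZ] at h1
  obtain ⟨W, hW⟩ := (A.lcs 1).exists_isCompl
  have hW2 : Module.finrank F W = 2 := by
    have := Submodule.finrank_add_eq_of_isCompl hW
    omega
  let e := Module.finBasisOfFinrankEq F W hW2
  have hle := A.lcs_one_le_sup_span (a := (e 0 : L)) (b := (e 1 : L)) fun x => by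
    obtain ⟨s, hs, w, hw, rfl⟩ := Submodule.mem_sup.1 (hW.sup_eq_top ▸ Submodule.mem_top (x := x))
    refine ⟨s, hs, e.repr ⟨w, hw⟩ 0, e.repr ⟨w, hw⟩ 1, ?_⟩
    have := congrArg Subtype.val (e.sum_repr ⟨w, hw⟩)
    simp only [Fin.sum_univ_two, Submodule.coe_add, Submodule.coe_smul] at this
    rw [this]
  have hupper := (Submodule.finrank_mono hle).trans
    (Submodule.finrank_add_le_finrank_add_finrank _ _)
  have hspan := finrank_span_le_card (R := F) {A.mul (e 0 : L) (e 1 : L)}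
  rw [Set.toFinset_singleton, Finset.card_singleton] at hspan
  have hlower : Module.finrank F (A.lcs 2) < Module.finrank F (A.lcs 1) :=
    Submodule.finrank_lt_finrank_of_lt (hnil.lcs_succ_lt (i := 1) fun h => by
      rw [h, finrank_bot] at h1
      omega)
  omega
end

section
/- Let F be a field and let m, n be natural numbers with 2n ≥ 8 and Ω(m) < n ≤ (Ω(m)+Ω(m+1))/2. Then there exists a nilpotent symplectic alternating algebra L of dimension 2n over F with dim Z(L) = 2 whose nilpotency class is exactly 2m+1. -/
/-- A symplectic alternating algebra over `F`, bundled with its carrier space. -/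
structure SAABundle (F : Type) [Field F] where
  carrier : Type
  [grp : AddCommGroup carrier]
  [mod : Module F carrier]
  alg : SAAStruct F carrier

attribute [instance] SAABundle.grp SAABundle.mod

/-- An alternating bilinear map is antisymmetric. -/
theorem bilin_swap {F V V' : Type*} [Field F] [AddCommGroup V] [Module F V] [AddCommGroup V']
    [Module F V'] {B : V →ₗ[F] V →ₗ[F] V'} (hB : ∀ x, B x x = 0) (x y : V) : B x y = -B y x := by
  have h := hB (x + y)
  simp only [map_add, LinearMap.add_apply, hB, zero_add, add_zero] at h
  exact eq_neg_of_add_eq_zero_right h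

theorem choose_two_succ (b : ℕ) : (b + 1).choose 2 = b + b.choose 2 := by
  simp [Nat.choose_succ_succ' b 1]

namespace SAAStruct

section General

variable {F : Type*} [Field F] {L : Type*} [AddCommGroup L] [Module F L] (A : SAAStruct F L)

theorem mul_swap (x y : L) : A.mul x y = -A.mul y x := bilin_swap A.mul_alt x y

theorem form_swap (x y : L) : A.form x y = -A.form y x := bilin_swap A.form_alt x y

theorem form_mul_right_s8 (x y z : L) : A.form x (A.mul y z) = A.form (A.mul x z) y := by
  rw [A.form_swap, A.cyclic, A.mul_swap z x]
  simp

/-- A descending central condition together with the two end conditions is a central chain. -/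
theorem CentralChain.of_mul_mem {I : ℕ → Submodule F L} {k : ℕ} (h0 : I 0 = ⊥) (hk : I k = ⊤)
    (hmono : ∀ s < k, I s ≤ I (s + 1))
    (hmul : ∀ s < k, ∀ x ∈ I (s + 1), ∀ y : L, A.mul x y ∈ I s) : A.CentralChain I k := by
  refine ⟨h0, hk, hmono, fun s hs x hx y => ?_, hmul⟩
  cases s with
  | zero =>
    rw [h0, Submodule.mem_bot] at hx
    simp [hx]
  | succ s => exact hmono s hs (hmul s hs x hx y)

variable {A}

theorem mul_mem_lcs {i : ℕ} {x : L} (hx : x ∈ A.lcs i) (y : L) : A.mul x y ∈ A.lcs (i + 1) :=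
  Submodule.subset_span ⟨x, hx, y, rfl⟩

theorem CentralChain.lcs_le {I : ℕ → Submodule F L} {k : ℕ} (h : A.CentralChain I k) (j : ℕ) :
    A.lcs j ≤ I (k - j) := by
  induction j with
  | zero => simp [h.2.1]
  | succ j ih =>
    rw [lcs, Submodule.span_le]
    rintro _ ⟨u, hu, v, rfl⟩
    have hu' := ih hu
    rcases Nat.eq_zero_or_pos (k - j) with h' | h'
    · rw [h', h.1, Submodule.mem_bot] at hu'
      simp [hu']
    · have e : k - j = k - (j + 1) + 1 := by omega
      rw [e] at hu'
      exact h.2.2.2.2 _ (by omega) _ hu' v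

/-- The `i`-th term of a central chain is orthogonal to `L^(j+1)` for `i ≤ j`. -/
theorem CentralChain.form_eq_zero {I : ℕ → Submodule F L} {k : ℕ} (h : A.CentralChain I k) :
    ∀ i ≤ k, ∀ j, i ≤ j → ∀ x ∈ I i, ∀ y ∈ A.lcs j, A.form x y = 0 := by
  intro i
  induction i with
  | zero =>
    intro _ j _ x hx y _
    rw [h.1, Submodule.mem_bot] at hx
    simp [hx]
  | succ i ih =>
    intro hik j hij x hx y hy
    obtain ⟨j, rfl⟩ : ∃ j', j = j' + 1 := ⟨j - 1, by omega⟩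
    rw [lcs] at hy
    induction hy using Submodule.span_induction with
    | mem y hy =>
      obtain ⟨u, hu, v, rfl⟩ := hy
      rw [form_mul_right_s8]
      exact ih (by omega) j (by omega) _ (h.2.2.2.2 i hik x hx v) u hu
    | zero => simp
    | add a b _ _ ha hb => simp [ha, hb]
    | smul c a _ ha => simp [ha]

/-- If `L^(m+1)` is not isotropic then every central chain has length at least `2m+1`. -/
theorem CentralChain.le_length {I : ℕ → Submodule F L} {k m : ℕ} (h : A.CentralChain I k)
    (hiso : ¬ A.Isotropic (A.lcs m)) : 2 * m + 1 ≤ k := by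
  by_contra hk
  exact hiso fun u hu v hv =>
    h.form_eq_zero (k - m) (by omega) m (by omega) u (h.lcs_le m hu) v hv

theorem nilClass_eq {I : ℕ → Submodule F L} {m : ℕ} (h : A.CentralChain I (2 * m + 1))
    (hiso : ¬ A.Isotropic (A.lcs m)) : A.nilClass = 2 * m + 1 := by
  apply le_antisymm
  · exact Nat.sInf_le ⟨I, h⟩
  · refine le_csInf ⟨2 * m + 1, I, h⟩ ?_
    rintro k ⟨J, hJ⟩
    exact hJ.le_length hiso

end General

section DualExtension

variable {F : Type*} [Field F] {E W : Type*} [AddCommGroup E] [Module F E]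
  [AddCommGroup W] [Module F W]

/-- The symplectic alternating algebra on `E* × W × E` built from an alternating algebra `E`, an
alternating map `φ : E × E → W` and a symplectic form on `W`. -/
def dualExtension (μ : E →ₗ[F] E →ₗ[F] E) (hμ : ∀ e, μ e e = 0)
    (φ : E →ₗ[F] E →ₗ[F] W) (hφ : ∀ e, φ e e = 0)
    (ω : W →ₗ[F] W →ₗ[F] F) (hω : ∀ w, ω w w = 0) (hω' : ∀ w, (∀ v, ω w v = 0) → w = 0) :
    SAAStruct F (Module.Dual F E × W × E) where
  form := LinearMap.mk₂ F (fun X Y => X.1 Y.2.2 - Y.1 X.2.2 + ω X.2.1 Y.2.1)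
    (by intro X X' Y; simp; ring) (by intro c X Y; simp; ring)
    (by intro X Y Y'; simp; ring) (by intro c X Y; simp; ring)
  mul := LinearMap.mk₂ F
    (fun X Y => (Y.1 ∘ₗ μ X.2.2 - X.1 ∘ₗ μ Y.2.2 + ω Y.2.1 ∘ₗ φ X.2.2 - ω X.2.1 ∘ₗ φ Y.2.2,
      φ X.2.2 Y.2.2, μ X.2.2 Y.2.2))
    (by intro X X' Y; ext <;> simp; ring) (by intro c X Y; ext <;> simp; ring)
    (by intro X Y Y'; ext <;> simp; ring) (by intro c X Y; ext <;> simp; ring)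
  form_alt X := by simp [hω]
  form_nondegen X h := by
    obtain ⟨ξ, w, e⟩ := X
    simp only [LinearMap.mk₂_apply] at h
    have he : e = 0 := by
      rw [← Module.forall_dual_apply_eq_zero_iff F]
      intro ξ'
      simpa using h (ξ', 0, 0)
    have hw : w = 0 := hω' w fun v => by simpa using h (0, v, 0)
    have hξ : ξ = 0 := by
      ext e'
      simpa using h (0, 0, e')
    simp [he, hw, hξ]
  mul_alt X := by simp [hμ, hφ]
  cyclic X Y Z := by
    have hμ' : ∀ a b, μ a b = -μ b a := bilin_swap hμ
    have hφ' : ∀ a b, φ a b = -φ b a := bilin_swap hφ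
    have hω'' : ∀ a b, ω a b = -ω b a := bilin_swap hω
    simp only [LinearMap.mk₂_apply, LinearMap.add_apply, LinearMap.sub_apply,
      LinearMap.comp_apply]
    rw [hω'' (φ X.2.2 Y.2.2), hω'' (φ Y.2.2 Z.2.2), hμ' Z.2.2 X.2.2, hφ' Z.2.2 X.2.2,
      hμ' Y.2.2 X.2.2, hφ' Y.2.2 X.2.2]
    simp only [map_neg]
    ring

variable {μ : E →ₗ[F] E →ₗ[F] E} {hμ : ∀ e, μ e e = 0}
  {φ : E →ₗ[F] E →ₗ[F] W} {hφ : ∀ e, φ e e = 0}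
  {ω : W →ₗ[F] W →ₗ[F] F} {hω : ∀ w, ω w w = 0} {hω' : ∀ w, (∀ v, ω w v = 0) → w = 0}

theorem dualExtension_form (X Y : Module.Dual F E × W × E) :
    (dualExtension μ hμ φ hφ ω hω hω').form X Y =
      X.1 Y.2.2 - Y.1 X.2.2 + ω X.2.1 Y.2.1 := rfl

theorem dualExtension_mul (X Y : Module.Dual F E × W × E) :
    (dualExtension μ hμ φ hφ ω hω hω').mul X Y =
      (Y.1 ∘ₗ μ X.2.2 - X.1 ∘ₗ μ Y.2.2 + ω Y.2.1 ∘ₗ φ X.2.2 - ω X.2.1 ∘ₗ φ Y.2.2,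
        φ X.2.2 Y.2.2, μ X.2.2 Y.2.2) := rfl

/-- The chain of subspaces of `E* × W × E` induced by a descending filtration of `E`. -/
def dualChain (W : Type*) [AddCommGroup W] [Module F W] (G : ℕ → Submodule F E) (m s : ℕ) :
    Submodule F (Module.Dual F E × W × E) :=
  if s ≤ m then (G s).dualAnnihilator.prod ⊥
  else (⊤ : Submodule F (Module.Dual F E)).prod ((⊤ : Submodule F W).prod (G (2 * m + 1 - s)))

theorem dualExtension_centralChain {G : ℕ → Submodule F E} {m : ℕ} (hG0 : G 0 = ⊤)
    (hGm : G m = ⊥) (hG : Antitone G) (hGμ : ∀ j, ∀ x ∈ G j, ∀ y, μ x y ∈ G (j + 1)) :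
    (dualExtension μ hμ φ hφ ω hω hω').CentralChain (dualChain W G m) (2 * m + 1) := by
  have hμ' : ∀ a b, μ a b = -μ b a := bilin_swap hμ
  apply CentralChain.of_mul_mem
  · simp [dualChain, hG0]
  · simp [dualChain, hG0, show ¬ (2 * m + 1 ≤ m) by omega]
  · intro s _
    unfold dualChain
    split_ifs with h1 h2
    · exact Submodule.prod_mono (Submodule.dualAnnihilator_anti (hG (by omega))) le_rfl
    · exact Submodule.prod_mono le_top bot_le
    · omega
    · exact Submodule.prod_mono le_rfl (Submodule.prod_mono le_rfl (hG (by omega)))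
  · rintro s hs ⟨ξ, w, e⟩ hx ⟨ξ', w', e'⟩
    rw [dualExtension_mul]
    unfold dualChain at hx ⊢
    split_ifs at hx ⊢ with h1 h2
    · simp only [Submodule.mem_prod, Submodule.mem_bot, Prod.mk_eq_zero,
        Submodule.mem_dualAnnihilator] at hx ⊢
      obtain ⟨hξ, rfl, rfl⟩ := hx
      refine ⟨fun a ha => ?_, by simp, by simp⟩
      have := hξ _ (hGμ s a ha e')
      rw [hμ', map_neg, neg_eq_zero] at this
      simpa using this
    · have : s = m := by omega
      subst this
      have hs' : 2 * s + 1 - (s + 1) = s := by omega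
      rw [hs', hGm] at hx
      simp only [Submodule.mem_prod, Submodule.mem_bot, Submodule.mem_top, true_and] at hx
      subst hx
      simp [hGm]
    · omega
    · simp only [Submodule.mem_prod, Submodule.mem_top, true_and] at hx ⊢
      have hs' : 2 * m + 1 - s = 2 * m + 1 - (s + 1) + 1 := by omega
      rw [hs']
      exact hGμ _ _ hx _

end DualExtension

end SAAStruct

/-- A symplectic form exists in every even dimension. -/
theorem exists_symplectic_form (F : Type*) [Field F] (r : ℕ) :
    ∃ ω : (Fin (2 * r) → F) →ₗ[F] (Fin (2 * r) → F) →ₗ[F] F,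
      (∀ w, ω w w = 0) ∧ ∀ w, (∀ v, ω w v = 0) → w = 0 := by
  let V := Fin r → F
  let ω₀ : Module.Dual F V × V →ₗ[F] Module.Dual F V × V →ₗ[F] F :=
    LinearMap.mk₂ F (fun X Y => X.1 Y.2 - Y.1 X.2)
      (by intro X X' Y; simp; ring) (by intro c X Y; simp; ring)
      (by intro X Y Y'; simp; ring) (by intro c X Y; simp; ring)
  let f : (Fin (2 * r) → F) ≃ₗ[F] Module.Dual F V × V :=
    LinearEquiv.ofFinrankEq _ _ (by
      rw [Module.finrank_prod, Subspace.dual_finrank_eq]; simp [V]; ring)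
  refine ⟨ω₀.compl₁₂ f.toLinearMap f.toLinearMap, fun w => by simp [ω₀], fun w h => ?_⟩
  have h' : ∀ Y : Module.Dual F V × V, (f w).1 Y.2 - Y.1 (f w).2 = 0 := fun Y => by
    simpa [ω₀] using h (f.symm Y)
  rw [← f.map_eq_zero_iff]
  apply Prod.ext
  · ext e
    simpa using h' (0, Pi.single e 1)
  · exact (Module.forall_dual_apply_eq_zero_iff F _).1 fun ξ => by simpa using h' (ξ, 0)

/-- The alternating bilinear map on `F^N` with `(e_a, e_b) ↦ c a b` for `a < b`. -/
def altMap {F V : Type*} [Field F] [AddCommGroup V] [Module F V] {N : ℕ}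
    (c : Fin N → Fin N → V) : (Fin N → F) →ₗ[F] (Fin N → F) →ₗ[F] V :=
  LinearMap.mk₂ F (fun x y => ∑ a, ∑ b, (if a < b then x a * y b - x b * y a else 0) • c a b)
    (by
      intro x x' y
      simp only [← Finset.sum_add_distrib, ← add_smul]
      refine Finset.sum_congr rfl fun a _ => Finset.sum_congr rfl fun b _ => ?_
      congr 1
      split_ifs <;> simp; ring)
    (by
      intro t x y
      simp only [Finset.smul_sum, ← mul_smul]
      refine Finset.sum_congr rfl fun a _ => Finset.sum_congr rfl fun b _ => ?_
      congr 1
      split_ifs <;> simp; ring)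
    (by
      intro x y y'
      simp only [← Finset.sum_add_distrib, ← add_smul]
      refine Finset.sum_congr rfl fun a _ => Finset.sum_congr rfl fun b _ => ?_
      congr 1
      split_ifs <;> simp; ring)
    (by
      intro t x y
      simp only [Finset.smul_sum, ← mul_smul]
      refine Finset.sum_congr rfl fun a _ => Finset.sum_congr rfl fun b _ => ?_
      congr 1
      split_ifs <;> simp; ring)

section altMap

variable {F V : Type*} [Field F] [AddCommGroup V] [Module F V] {N : ℕ} (c : Fin N → Fin N → V)

theorem altMap_apply (x y : Fin N → F) :
    altMap c x y = ∑ a, ∑ b, (if a < b then x a * y b - x b * y a else 0) • c a b := rfl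

theorem altMap_self (x : Fin N → F) : altMap c x x = 0 := by
  simp [altMap_apply, mul_comm]

theorem altMap_apply_single (x : Fin N → F) (b : Fin N) :
    altMap c x (Pi.single b 1) =
      ∑ a, x a • ((if a < b then c a b else 0) - (if b < a then c b a else 0)) := by
  have h : ∀ a' b' : Fin N,
      (if a' < b' then x a' * Pi.single (M := fun _ => F) b 1 b'
        - x b' * Pi.single (M := fun _ => F) b 1 a' else 0) • c a' b'
      = (if b' = b then (if a' < b then x a' • c a' b else 0) else 0)
        - (if a' = b then (if b < b' then x b' • c b b' else 0) else 0) := by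
    intro a' b'
    by_cases h1 : a' = b <;> by_cases h2 : b' = b
    · subst h1; subst h2; simp
    · subst h1; by_cases h3 : a' < b' <;> simp [h2, h3]
    · subst h2; by_cases h3 : a' < b' <;> simp [h1, h3]
    · simp [h1, h2]
  simp only [altMap_apply, h, Finset.sum_sub_distrib, smul_sub]
  congr 1
  · simp
  · rw [Finset.sum_comm]; simp

theorem altMap_single_single {a b : Fin N} (hab : a < b) :
    altMap c (Pi.single b (1 : F)) (Pi.single a 1) = -c a b := by
  rw [altMap_apply_single, Finset.sum_eq_single b]
  · simp [hab, hab.le]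
  · intro a' _ h; simp [h]
  · simp

end altMap

/-- The position of the product `e_a e_b`, `a < b`, among the basis elements of the free
alternating algebra on two generators. -/
def pairIdx (a b : ℕ) : ℕ := 2 + b.choose 2 + a

theorem exists_pairIdx_eq {k : ℕ} (hk : 2 ≤ k) : ∃ a b, a < b ∧ pairIdx a b = k := by
  induction k, hk using Nat.le_induction with
  | base => exact ⟨0, 1, by simp, by simp [pairIdx]⟩
  | succ k hk ih =>
    obtain ⟨a, b, hab, rfl⟩ := ih
    rcases Nat.lt_or_ge (a + 1) b with h | h
    · exact ⟨a + 1, b, h, by simp only [pairIdx]; omega⟩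
    · have : a + 1 = b := by omega
      subst this
      refine ⟨0, a + 2, by omega, ?_⟩
      simp only [pairIdx, choose_two_succ]
      omega

theorem lt_two_add_choose_two (N : ℕ) : N < 2 + N.choose 2 := by
  cases N with
  | zero => simp
  | succ N =>
    rw [choose_two_succ]
    omega

theorem lt_of_pairIdx_lt {a b N : ℕ} (h : pairIdx a b < 2 + N.choose 2) : b < N := by
  by_contra hb
  have := Nat.choose_le_choose 2 (not_lt.1 hb)
  simp only [pairIdx] at h
  omega

theorem le_of_le_pairIdx {a b N : ℕ} (hab : a < b) (h : 2 + N.choose 2 ≤ pairIdx a b) :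
    N ≤ b := by
  by_contra hb
  have h1 := Nat.choose_le_choose 2 (show b + 1 ≤ N by omega)
  simp only [pairIdx] at h
  rw [choose_two_succ] at h1
  omega

theorem OmegaFn_succ (m : ℕ) : OmegaFn (m + 1) = 2 + (OmegaFn m).choose 2 := rfl

theorem OmegaFn_mono : Monotone OmegaFn := by
  apply monotone_nat_of_le_succ
  intro m
  induction m with
  | zero => simp [OmegaFn]
  | succ m ih =>
    rw [OmegaFn_succ, OmegaFn_succ (m + 1)]
    have := Nat.choose_le_choose 2 ih
    omega

theorem three_le_OmegaFn {m : ℕ} (hm : 2 ≤ m) : 3 ≤ OmegaFn m := by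
  have := OmegaFn_mono hm
  simpa [OmegaFn] using this

section Construction

variable (F : Type*) [Field F]

/-- The truncation to dimension `N` of the free alternating algebra on two generators. -/
def freeMul (N : ℕ) : (Fin N → F) →ₗ[F] (Fin N → F) →ₗ[F] (Fin N → F) :=
  altMap fun a b k => if pairIdx a b = k then 1 else 0

/-- The products landing in the middle layer: the first `R - 1` basis products of index at least
`N` are sent to distinct basis vectors, and the last coordinate is a form of rank at least
`N - 1`. -/
def midMul (N R : ℕ) : (Fin N → F) →ₗ[F] (Fin N → F) →ₗ[F] (Fin R → F) :=
  altMap fun a b t =>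
    if (t : ℕ) + 1 = R then (if (b : ℕ) = a + 1 ∧ ((b : ℕ) + N) % 2 = 1 then 1 else 0)
    else if pairIdx a b = N + t then 1 else 0

/-- The filtration of `F^N` by the vanishing of the first `Ω(j)` coordinates. -/
def tailSub (N j : ℕ) : Submodule F (Fin N → F) where
  carrier := {x | ∀ k : Fin N, (k : ℕ) < OmegaFn j → x k = 0}
  add_mem' := by intro x y hx hy k hk; simp [hx k hk, hy k hk]
  zero_mem' := by intro k _; rfl
  smul_mem' := by intro c x hx k hk; simp [hx k hk]

variable {F}

theorem freeMul_self (N : ℕ) (x : Fin N → F) : freeMul F N x x = 0 := altMap_self _ x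

theorem midMul_self (N R : ℕ) (x : Fin N → F) : midMul F N R x x = 0 := altMap_self _ x

theorem mem_tailSub {N j : ℕ} {x : Fin N → F} :
    x ∈ tailSub F N j ↔ ∀ k : Fin N, (k : ℕ) < OmegaFn j → x k = 0 := Iff.rfl

theorem tailSub_zero (N : ℕ) : tailSub F N 0 = ⊤ := by
  ext x; simp [mem_tailSub, OmegaFn]

theorem tailSub_eq_bot (m : ℕ) : tailSub F (OmegaFn m) m = ⊥ := by
  ext x
  simp only [mem_tailSub, Submodule.mem_bot]
  exact ⟨fun h => funext fun k => h k k.2, fun h k _ => by simp [h]⟩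

theorem tailSub_antitone (N : ℕ) : Antitone (tailSub F N) := fun _ _ hij _ hx k hk =>
  hx k (hk.trans_le (OmegaFn_mono hij))

theorem freeMul_mem_tailSub {N j : ℕ} {x : Fin N → F} (hx : x ∈ tailSub F N j)
    (y : Fin N → F) : freeMul F N x y ∈ tailSub F N (j + 1) := by
  intro k hk
  rw [freeMul, altMap_apply]
  simp only [Finset.sum_apply, Pi.smul_apply, smul_eq_mul]
  refine Finset.sum_eq_zero fun a _ => Finset.sum_eq_zero fun b _ => ?_
  split_ifs with hab hidx
  · have hb : (b : ℕ) < OmegaFn j := lt_of_pairIdx_lt (hidx ▸ hk)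
    have ha : (a : ℕ) < OmegaFn j := lt_trans hab hb
    simp [hx a ha, hx b hb]
  all_goals simp

theorem freeMul_apply_of_lt_two {N : ℕ} (x y : Fin N → F) {k : Fin N} (hk : (k : ℕ) < 2) :
    freeMul F N x y k = 0 :=
  freeMul_mem_tailSub (j := 0) (by simp [tailSub_zero]) y k (by simpa [OmegaFn] using hk)

theorem freeMul_single {N : ℕ} {a b k : Fin N} (hab : a < b) (h : pairIdx a b = k) :
    freeMul F N (Pi.single b 1) (Pi.single a 1) = -Pi.single k 1 := by
  rw [freeMul, altMap_single_single _ hab]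
  congr 1
  funext l
  simp [h, Pi.single_apply, Fin.ext_iff, eq_comm]

theorem freeMul_single_eq_zero {N : ℕ} {a b : Fin N} (hab : a < b) (h : N ≤ pairIdx a b) :
    freeMul F N (Pi.single b 1) (Pi.single a 1) = 0 := by
  rw [freeMul, altMap_single_single _ hab, neg_eq_zero]
  funext l
  rw [if_neg (by omega)]; rfl

/-- The middle layer is spanned by products of basis vectors whose product in the truncated free
algebra vanishes. -/
theorem span_midMul {N R : ℕ} (hN : 2 ≤ N) (hR : N + R ≤ 2 + N.choose 2) (hR0 : 0 < R) :
    Submodule.span F {w | ∃ a b : Fin N, a < b ∧ N ≤ pairIdx a b ∧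
      w = midMul F N R (Pi.single b 1) (Pi.single a 1)} = ⊤ := by
  set S := Submodule.span F {w | ∃ a b : Fin N, a < b ∧ N ≤ pairIdx a b ∧
      w = midMul F N R (Pi.single b 1) (Pi.single a 1)} with hS
  have hmem : ∀ a b : Fin N, a < b → N ≤ pairIdx a b →
      (fun t : Fin R => if (t : ℕ) + 1 = R then
        (if (b : ℕ) = a + 1 ∧ ((b : ℕ) + N) % 2 = 1 then (1 : F) else 0)
        else if pairIdx a b = N + t then 1 else 0) ∈ S := by
    intro a b hab h
    rw [← neg_mem_iff]
    apply Submodule.subset_span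
    exact ⟨a, b, hab, h, by rw [midMul, altMap_single_single _ hab]⟩
  have hlast : (Pi.single ⟨R - 1, by omega⟩ 1 : Fin R → F) ∈ S := by
    have hidx : pairIdx (N - 2) (N - 1) + 1 = 2 + N.choose 2 := by
      obtain ⟨M, rfl⟩ : ∃ M, N = M + 2 := ⟨N - 2, by omega⟩
      simp only [pairIdx, choose_two_succ, Nat.add_sub_cancel, show M + 2 - 1 = M + 1 by omega]
      omega
    have h := hmem ⟨N - 2, by omega⟩ ⟨N - 1, by omega⟩ (Fin.mk_lt_mk.2 (by omega))
      (by simp only; omega)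
    convert h using 1
    funext t
    simp only [Pi.single_apply, Fin.ext_iff]
    have ht := t.2
    by_cases h1 : (t : ℕ) + 1 = R
    · rw [if_pos (by omega), if_pos h1, if_pos (by omega)]
    · rw [if_neg (by omega), if_neg h1, if_neg (by omega)]
  rw [eq_top_iff, ← (Pi.basisFun F (Fin R)).span_eq, Submodule.span_le]
  rintro _ ⟨t, rfl⟩
  rw [Pi.basisFun_apply]
  have ht := t.2
  by_cases h1 : (t : ℕ) + 1 = R
  · rwa [show t = ⟨R - 1, by omega⟩ by ext; simp; omega]
  · obtain ⟨a, b, hab, hidx⟩ := exists_pairIdx_eq (show 2 ≤ N + (t : ℕ) by omega)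
    have hb : b < N := lt_of_pairIdx_lt (a := a) (by omega)
    have h := hmem ⟨a, hab.trans hb⟩ ⟨b, hb⟩ hab (by simp only; omega)
    have h' := S.sub_mem h (S.smul_mem
      (if b = a + 1 ∧ (b + N) % 2 = 1 then (1 : F) else 0) hlast)
    rw [SetLike.mem_coe]
    convert h' using 1
    funext s
    simp only [Pi.single_apply, Fin.ext_iff, Pi.sub_apply, Pi.smul_apply, smul_eq_mul]
    have hs := s.2
    by_cases h2 : (s : ℕ) + 1 = R
    · rw [if_neg (by omega), if_pos h2, if_pos (show (s : ℕ) = R - 1 by omega)]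
      simp
    · rw [if_neg h2, if_neg (show ¬ (s : ℕ) = R - 1 by omega)]
      simp only [mul_zero, sub_zero, hidx]
      congr 1
      simp [eq_comm]

theorem eq_zero_of_mul_eq_zero {N R : ℕ} (hN : 3 ≤ N) (hR : 0 < R) {x : Fin N → F}
    (h1 : ∀ y, freeMul F N x y = 0) (h2 : ∀ y, midMul F N R x y = 0) : x = 0 := by
  have hlast : ∀ b : Fin N, ∑ a : Fin N, x a * ((if a < b then
      (if (b : ℕ) = a + 1 ∧ ((b : ℕ) + N) % 2 = 1 then (1 : F) else 0) else 0) -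
      (if b < a then
      (if (a : ℕ) = b + 1 ∧ ((a : ℕ) + N) % 2 = 1 then (1 : F) else 0) else 0)) = 0 := by
    intro b
    have h := congrFun (h2 (Pi.single b 1)) ⟨R - 1, by omega⟩
    rw [midMul, altMap_apply_single] at h
    simp only [Finset.sum_apply, Pi.smul_apply, smul_eq_mul, Pi.sub_apply, Pi.zero_apply] at h
    rw [← h]
    refine Finset.sum_congr rfl fun a _ => ?_
    have e : R - 1 + 1 = R := by omega
    congr 2 <;> split_ifs <;> simp_all
  funext k
  have hk := k.2
  by_cases hodd : ((k : ℕ) + N) % 2 = 1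
  · by_cases hk0 : (k : ℕ) = 0
    · have h := congrFun (h1 (Pi.single ⟨1, by omega⟩ 1)) ⟨2, by omega⟩
      rw [freeMul, altMap_apply_single] at h
      simp only [Finset.sum_apply, Pi.smul_apply, smul_eq_mul, Pi.sub_apply, ite_apply,
        Pi.zero_apply] at h
      rw [Finset.sum_eq_single k] at h
      · have e : k < ⟨1, by omega⟩ := by rw [Fin.lt_def]; simp [hk0]
        rw [if_pos e, if_neg (not_lt_of_gt e)] at h
        simpa [hk0, pairIdx] using h
      · intro a _ ha
        have ha' : 0 < (a : ℕ) := by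
          rw [Ne, Fin.ext_iff] at ha; omega
        have e : ¬ a < ⟨1, by omega⟩ := by rw [Fin.lt_def]; simp; omega
        rw [if_neg e]
        split_ifs with h3 h4
        · simp only [pairIdx] at h4
          omega
        · simp
        · simp
      · simp
    · have h := hlast ⟨(k : ℕ) - 1, by omega⟩
      rw [Finset.sum_eq_single k] at h
      · rw [if_neg (by rw [Fin.lt_def]; simp), if_pos (by rw [Fin.lt_def]; simp; omega),
          if_pos ⟨by simp; omega, hodd⟩] at h
        simpa using h
      · intro a _ ha
        rw [Ne, Fin.ext_iff] at ha
        simp only [Fin.lt_def]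
        split_ifs <;> first | omega | simp
      · simp
  · have h := hlast ⟨(k : ℕ) + 1, by omega⟩
    rw [Finset.sum_eq_single k] at h
    · rw [if_pos (by rw [Fin.lt_def]; simp), if_pos ⟨rfl, by simp only; omega⟩,
        if_neg (by rw [Fin.lt_def]; simp)] at h
      simpa using h
    · intro a _ ha
      rw [Ne, Fin.ext_iff] at ha
      simp only [Fin.lt_def]
      split_ifs <;> first | omega | simp
    · simp

open SAAStruct

variable {m R : ℕ} {ω : (Fin R → F) →ₗ[F] (Fin R → F) →ₗ[F] F} (hω : ∀ w, ω w w = 0)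
  (hω' : ∀ w, (∀ v, ω w v = 0) → w = 0)

/-- The algebra `E* × F^R × E` on the truncated free alternating algebra `E = F^N`. -/
abbrev minClassAlg (N : ℕ) :
    SAAStruct F (Module.Dual F (Fin N → F) × (Fin R → F) × (Fin N → F)) :=
  dualExtension (freeMul F N) (freeMul_self N) (midMul F N R) (midMul_self N R) ω hω hω'

theorem single_mem_map_lcs {N : ℕ} (j : ℕ) (k : Fin N) (hk : OmegaFn j ≤ k) :
    ∃ X ∈ (minClassAlg hω hω' N).lcs j, X.2.2 = Pi.single k 1 := by
  induction j generalizing k with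
  | zero => exact ⟨(0, 0, Pi.single k 1), trivial, rfl⟩
  | succ j ih =>
    rw [OmegaFn_succ] at hk
    obtain ⟨a, b, hab, hidx⟩ := exists_pairIdx_eq (show 2 ≤ (k : ℕ) by omega)
    have hbN : b < N := lt_of_pairIdx_lt (a := a) (by
      have := k.2
      have := lt_two_add_choose_two N
      omega)
    obtain ⟨X, hX, hXe⟩ := ih ⟨b, hbN⟩ (le_of_le_pairIdx hab (hidx ▸ hk))
    refine ⟨-_, neg_mem (mul_mem_lcs hX (0, 0, Pi.single ⟨a, hab.trans hbN⟩ 1)), ?_⟩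
    rw [dualExtension_mul]
    simp only [Prod.snd_neg, hXe]
    rw [freeMul_single (k := k) (Fin.mk_lt_mk.2 hab) hidx, neg_neg]

theorem mid_mem_map_lcs (hm : 1 ≤ m) (hN : 2 ≤ OmegaFn m) (hR0 : 0 < R)
    (hR : OmegaFn m + R ≤ OmegaFn (m + 1)) (w : Fin R → F) :
    ∃ X ∈ (minClassAlg hω hω' (OmegaFn m)).lcs m, X.2.1 = w ∧ X.2.2 = 0 := by
  have hw : w ∈ Submodule.span F {w | ∃ a b : Fin (OmegaFn m), a < b ∧
      OmegaFn m ≤ pairIdx a b ∧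
      w = midMul F (OmegaFn m) R (Pi.single b 1) (Pi.single a 1)} := by
    rw [span_midMul hN (by rwa [← OmegaFn_succ]) hR0]; trivial
  induction hw using Submodule.span_induction with
  | mem w hw =>
    obtain ⟨a, b, hab, hidx, rfl⟩ := hw
    obtain ⟨m, rfl⟩ : ∃ m', m = m' + 1 := ⟨m - 1, by omega⟩
    obtain ⟨X, hX, hXe⟩ := single_mem_map_lcs hω hω' m b
      (le_of_le_pairIdx hab (by rwa [← OmegaFn_succ]))
    refine ⟨_, mul_mem_lcs hX (0, 0, Pi.single a 1), ?_, ?_⟩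
    · simp [dualExtension_mul, hXe]
    · simp only [dualExtension_mul, hXe]
      exact freeMul_single_eq_zero hab hidx
  | zero => exact ⟨0, zero_mem _, rfl, rfl⟩
  | add w w' _ _ h h' =>
    obtain ⟨X, hX, h1, h2⟩ := h
    obtain ⟨Y, hY, h3, h4⟩ := h'
    exact ⟨X + Y, add_mem hX hY, by simp [h1, h3], by simp [h2, h4]⟩
  | smul c w _ h =>
    obtain ⟨X, hX, h1, h2⟩ := h
    exact ⟨c • X, Submodule.smul_mem _ _ hX, by simp [h1], by simp [h2]⟩

theorem minClassAlg_not_isotropic (hm : 1 ≤ m) (hN : 2 ≤ OmegaFn m) (hR0 : 0 < R)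
    (hR : OmegaFn m + R ≤ OmegaFn (m + 1)) :
    ¬ (minClassAlg hω hω' (OmegaFn m)).Isotropic ((minClassAlg hω hω' (OmegaFn m)).lcs m) := by
  intro hiso
  have h1 : (Pi.single ⟨0, hR0⟩ 1 : Fin R → F) = 0 := by
    refine hω' _ fun v => ?_
    obtain ⟨X, hX, hXw, hXe⟩ := mid_mem_map_lcs hω hω' hm hN hR0 hR (Pi.single ⟨0, hR0⟩ 1)
    obtain ⟨Y, hY, hYw, hYe⟩ := mid_mem_map_lcs hω hω' hm hN hR0 hR v
    have h := hiso X hX Y hY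
    rw [dualExtension_form] at h
    simpa [hXw, hXe, hYw, hYe] using h
  simpa using congrFun h1 ⟨0, hR0⟩

theorem minClassAlg_center {N : ℕ} (hN : 3 ≤ N) (hR0 : 0 < R)
    (hR : N + R ≤ 2 + N.choose 2) :
    (minClassAlg hω hω' N).center =
      Submodule.span F (Set.range fun i : Fin 2 =>
        ((LinearMap.proj (Fin.castLE (by omega) i), 0, 0) :
          Module.Dual F (Fin N → F) × (Fin R → F) × (Fin N → F))) := by
  apply le_antisymm
  · rintro ⟨ξ, w, e⟩ hX
    have hX' : ∀ Y, (minClassAlg hω hω' N).mul (ξ, w, e) Y = 0 := fun Y => by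
      have hX : (minClassAlg hω hω' N).mul (ξ, w, e) = 0 := hX
      rw [hX]; rfl
    simp only [dualExtension_mul] at hX'
    have he : e = 0 := by
      apply eq_zero_of_mul_eq_zero hN hR0
      · intro y; exact congrArg (fun X => X.2.2) (hX' (0, 0, y))
      · intro y; exact congrArg (fun X => X.2.1) (hX' (0, 0, y))
    subst he
    have hk : ∀ y z, ξ (freeMul F N y z) + ω w (midMul F N R y z) = 0 := fun y z => by
      have h := congrArg (fun X => X.1 z) (hX' (0, 0, y))
      simp at h
      linear_combination -h
    have hw : w = 0 := by
      refine hω' w fun v => ?_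
      have hv : v ∈ Submodule.span F {w | ∃ a b : Fin N, a < b ∧ N ≤ pairIdx a b ∧
          w = midMul F N R (Pi.single b 1) (Pi.single a 1)} := by
        rw [span_midMul (by omega) hR hR0]; trivial
      induction hv using Submodule.span_induction with
      | mem v hv =>
        obtain ⟨a, b, hab, hidx, rfl⟩ := hv
        have h := hk (Pi.single b 1) (Pi.single a 1)
        rwa [freeMul_single_eq_zero hab hidx, map_zero, zero_add] at h
      | zero => simp
      | add a b _ _ ha hb => simp [ha, hb]
      | smul c a _ ha => simp [ha]
    subst hw
    have hξ : ∀ k : Fin N, 2 ≤ (k : ℕ) → ξ (Pi.single k 1) = 0 := by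
      intro k hk2
      obtain ⟨a, b, hab, hidx⟩ := exists_pairIdx_eq hk2
      have hbN : b < N := lt_of_pairIdx_lt (a := a) (by have := k.2; omega)
      have h := hk (Pi.single ⟨b, hbN⟩ 1) (Pi.single ⟨a, hab.trans hbN⟩ 1)
      rw [freeMul_single (k := k) (Fin.mk_lt_mk.2 hab) hidx] at h
      simpa using h
    rw [Submodule.mem_span_range_iff_exists_fun]
    refine ⟨fun i => ξ (Pi.single (Fin.castLE (by omega) i) 1), ?_⟩
    rw [Fin.sum_univ_two]
    refine Prod.ext ?_ (by simp)
    apply LinearMap.pi_ext'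
    intro k
    ext
    by_cases hk2 : 2 ≤ (k : ℕ)
    · have e0 : (Fin.castLE (by omega) (0 : Fin 2) : Fin N) ≠ k := by
        intro h; rw [← h] at hk2; simp at hk2
      have e1 : (Fin.castLE (by omega) (1 : Fin 2) : Fin N) ≠ k := by
        intro h; rw [← h] at hk2; simp at hk2
      simp [hξ k hk2, e0, e1]
    · have h2N : 2 ≤ N := by omega
      obtain ⟨i, rfl⟩ : ∃ i : Fin 2, k = Fin.castLE h2N i := ⟨⟨k, by omega⟩, rfl⟩
      fin_cases i <;> simp
  · rw [Submodule.span_le]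
    rintro _ ⟨i, rfl⟩
    change (minClassAlg hω hω' N).mul _ = 0
    refine LinearMap.ext fun Y => ?_
    rw [dualExtension_mul]
    have h : ∀ y, (LinearMap.proj (Fin.castLE (by omega) i) : Module.Dual F (Fin N → F)) ∘ₗ
        freeMul F N y = 0 := fun y => by
      refine LinearMap.ext fun z => ?_
      exact freeMul_apply_of_lt_two y z (by simp [i.2])
    simp [h]

theorem finrank_minClassAlg_center {N : ℕ} (hN : 3 ≤ N) (hR0 : 0 < R)
    (hR : N + R ≤ 2 + N.choose 2) :
    Module.finrank F (minClassAlg hω hω' N).center = 2 := by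
  rw [minClassAlg_center hω hω' hN hR0 hR, finrank_span_eq_card, Fintype.card_fin]
  rw [Fintype.linearIndependent_iff]
  intro g hg i
  have h := congrArg (fun X => X.1 (Pi.single (Fin.castLE (by omega) i) 1)) hg
  rw [Fin.sum_univ_two] at h
  fin_cases i <;> simpa [Pi.single_apply] using h

end Construction

/-- for a field `F` and `m, n` with `2n ≥ 8` and
`Ω(m) < n ≤ (Ω(m)+Ω(m+1))/2`, there is a nilpotent SAA of dimension `2n`
over `F` with 2-dimensional center and nilpotency class exactly `2m + 1`. -/
theorem stmt8 (F : Type) [Field F] (m n : ℕ) (h8 : 8 ≤ 2 * n)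
    (h1 : OmegaFn m < n) (h2 : 2 * n ≤ OmegaFn m + OmegaFn (m + 1)) :
    ∃ B : SAABundle F,
      FiniteDimensional F B.carrier ∧
      B.alg.IsNilpotent ∧
      Module.finrank F B.carrier = 2 * n ∧
      Module.finrank F B.alg.center = 2 ∧
      B.alg.nilClass = 2 * m + 1 := by
  have hm : 2 ≤ m := by
    by_contra hm
    obtain rfl | rfl : m = 0 ∨ m = 1 := by omega
    · simp [OmegaFn] at h2; omega
    · simp [OmegaFn] at h2; omega
  have hN := three_le_OmegaFn hm
  have hR0 : 0 < 2 * (n - OmegaFn m) := by omega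
  have hR : OmegaFn m + 2 * (n - OmegaFn m) ≤ OmegaFn (m + 1) := by omega
  obtain ⟨ω, hω, hω'⟩ := exists_symplectic_form F (n - OmegaFn m)
  have hchain := SAAStruct.dualExtension_centralChain
    (μ := freeMul F (OmegaFn m)) (hμ := freeMul_self _)
    (φ := midMul F (OmegaFn m) _) (hφ := midMul_self _ _) (hω := hω) (hω' := hω')
    (tailSub_zero _) (tailSub_eq_bot m) (tailSub_antitone _)
    (fun j x hx y => freeMul_mem_tailSub hx y)
  refine ⟨{ carrier := _, alg := minClassAlg hω hω' (OmegaFn m) }, ?_, ⟨_, _, hchain⟩, ?_, ?_, ?_⟩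
  · dsimp only
    infer_instance
  · dsimp only
    rw [Module.finrank_prod, Module.finrank_prod, Subspace.dual_finrank_eq]
    simp only [Module.finrank_fin_fun]
    omega
  · exact finrank_minClassAlg_center hω hω' hN hR0 (by rwa [← OmegaFn_succ])
  · exact SAAStruct.nilClass_eq hchain
      (minClassAlg_not_isotropic hω hω' (by omega) (by omega) hR0 hR)
end
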